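/- arXiv:2604.18458 — 11 statements merged into one kernel-verified Lean document; each statement's English description precedes it below -/
import Mathlib

section
/- Let S be the 2×2 complex matrix !![0,1; 1,0], and for n ∈ ℤ let T_n be the 2×2 complex matrix !![1, 2*n; 0, 1]. Let X = {v : Fin 2 → ℂ | ‖v 0‖ < ‖v 1‖} and Y = {v : Fin 2 → ℂ | ‖v 0‖ > ‖v 1‖}. Then: (i) for every v ∈ Y, the vector S.mulVec v lies in X; and (ii) for every n ∈ ℤ with n ≠ 0 and every v ∈ X, the vector (T_n).mulVec v lies in Y. -/
theorem stmt_0 :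
    (∀ v : Fin 2 → ℂ, ‖v 0‖ > ‖v 1‖ →
      ‖((!![0, 1; 1, 0] : Matrix (Fin 2) (Fin 2) ℂ).mulVec v) 0‖ <
        ‖((!![0, 1; 1, 0] : Matrix (Fin 2) (Fin 2) ℂ).mulVec v) 1‖) ∧
    (∀ n : ℤ, n ≠ 0 → ∀ v : Fin 2 → ℂ, ‖v 0‖ < ‖v 1‖ →
      ‖((!![1, 2 * (n : ℂ); 0, 1] : Matrix (Fin 2) (Fin 2) ℂ).mulVec v) 0‖ >
        ‖((!![1, 2 * (n : ℂ); 0, 1] : Matrix (Fin 2) (Fin 2) ℂ).mulVec v) 1‖) := by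
  constructor
  · intro v h
    simpa [Matrix.mulVec, dotProduct, Fin.sum_univ_two] using h
  · intro n hn v h
    have e0 : ((!![1, 2 * (n : ℂ); 0, 1] : Matrix (Fin 2) (Fin 2) ℂ).mulVec v) 0
        = v 0 + 2 * (n : ℂ) * v 1 := by
      simp [Matrix.mulVec, dotProduct, Fin.sum_univ_two]
    have e1 : ((!![1, 2 * (n : ℂ); 0, 1] : Matrix (Fin 2) (Fin 2) ℂ).mulVec v) 1 = v 1 := by
      simp [Matrix.mulVec, dotProduct, Fin.sum_univ_two]
    rw [e0, e1]
    have h1 : (1 : ℝ) ≤ ‖(n : ℂ)‖ := by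
      rw [Complex.norm_intCast]
      exact_mod_cast Int.one_le_abs hn
    have h2 : ‖2 * (n : ℂ) * v 1‖ = 2 * ‖(n : ℂ)‖ * ‖v 1‖ := by
      rw [norm_mul, norm_mul, Complex.norm_ofNat]
    have h3 : ‖2 * (n : ℂ) * v 1‖ ≤ ‖v 0 + 2 * (n : ℂ) * v 1‖ + ‖v 0‖ := by
      have := norm_sub_le (v 0 + 2 * (n : ℂ) * v 1) (v 0)
      rwa [add_sub_cancel_left] at this
    have h4 := mul_le_mul_of_nonneg_right h1 (norm_nonneg (v 1))
    linarith
end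

section
/- Let S = !![0,1; 1,0] and T = !![1,2; 0,1], both invertible 2×2 integer matrices (elements of GL(2,ℤ)), and note S² = 1. Then the group homomorphism from the free product (ℤ/2ℤ) ∗ ℤ to GL(2,ℤ) determined by sending the generator of ℤ/2ℤ to S and the generator 1 ∈ ℤ to T is injective. In particular, the subgroup of GL(2,ℤ) generated by S and T is isomorphic to (ℤ/2ℤ) ∗ ℤ. -/
open Matrix

/-- The matrix `S = !![0,1;1,0]` as an element of `GL(2,ℤ)`; it satisfies `S² = 1`. -/
def Sgl : GL (Fin 2) ℤ :=
  ⟨!![0, 1; 1, 0], !![0, 1; 1, 0], by decide, by decide⟩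

/-- The matrix `T = !![1,2;0,1]` as an element of `GL(2,ℤ)`. -/
def Tgl : GL (Fin 2) ℤ :=
  ⟨!![1, 2; 0, 1], !![1, -2; 0, 1], by decide, by decide⟩

namespace PP

/-- The two-element family of groups whose coproduct is considered. -/
abbrev Fam (b : Bool) : Type := Bool.rec (Multiplicative (ZMod 2)) (Multiplicative ℤ) b

instance famGroup : ∀ b, Group (Fam b)
  | false => inferInstanceAs (Group (Multiplicative (ZMod 2)))
  | true => inferInstanceAs (Group (Multiplicative ℤ))

/-- The family of homomorphisms. -/
def hom {K : Type*} [Group K] (a : Multiplicative (ZMod 2) →* K) (b : Multiplicative ℤ →* K) :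
    ∀ i, Fam i →* K
  | false => a
  | true => b

/-- The ping-pong sets. -/
def X : Bool → Set (GL (Fin 2) ℤ)
  | false => {g | |g.1 0 0| < |g.1 1 0|}
  | true => {g | |g.1 1 0| < |g.1 0 0|}

/-- Comparison map from the binary coproduct to the indexed one. -/
def cmp : Monoid.Coprod (Multiplicative (ZMod 2)) (Multiplicative ℤ) →* Monoid.CoprodI Fam :=
  Monoid.Coprod.lift (Monoid.CoprodI.of (M := Fam) (i := false))
    (Monoid.CoprodI.of (M := Fam) (i := true))

lemma cmp_injective : Function.Injective cmp := by
  let back : Monoid.CoprodI Fam →* Monoid.Coprod (Multiplicative (ZMod 2)) (Multiplicative ℤ) :=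
    Monoid.CoprodI.lift (hom Monoid.Coprod.inl Monoid.Coprod.inr)
  have h : back.comp cmp = MonoidHom.id _ := by
    apply Monoid.Coprod.hom_ext
    · apply MonoidHom.ext
      intro x
      exact Monoid.CoprodI.lift_of (M := Fam)
        (hom (K := Monoid.Coprod (Multiplicative (ZMod 2)) (Multiplicative ℤ))
          Monoid.Coprod.inl Monoid.Coprod.inr) (i := false) x
    · apply MonoidHom.ext
      intro x
      exact Monoid.CoprodI.lift_of (M := Fam)
        (hom (K := Monoid.Coprod (Multiplicative (ZMod 2)) (Multiplicative ℤ))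
          Monoid.Coprod.inl Monoid.Coprod.inr) (i := true) x
  exact Function.LeftInverse.injective (g := back) (fun x => DFunLike.congr_fun h x)

lemma Tpow (n : ℤ) : ((Tgl ^ n : GL (Fin 2) ℤ)).1 = !![1, 2 * n; 0, 1] := by
  induction n using Int.induction_on with
  | zero => simp [Matrix.one_fin_two]
  | succ k ih =>
    rw [_root_.zpow_add_one, Units.val_mul, ih]
    simp [Tgl]; ring
  | pred k ih =>
    rw [_root_.zpow_sub_one, Units.val_mul, ih]
    simp [Tgl, Units.inv_mk]; ring

lemma arith (n x y : ℤ) (hn : n ≠ 0) (h : |x| < |y|) : |y| < |x + 2 * n * y| := by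
  have h1 : 1 ≤ |n| := Int.one_le_abs hn
  have h2 : |2 * n * y| = 2 * (|n| * |y|) := by rw [abs_mul, abs_mul]; simp [mul_assoc]
  have h3 : |2 * n * y| ≤ |x + 2 * n * y| + |x| := by
    have := abs_sub (x + 2 * n * y) x
    simpa using this
  nlinarith [abs_nonneg y]

open Pointwise in
lemma lift_inj (a : Multiplicative (ZMod 2) →* GL (Fin 2) ℤ) (b : Multiplicative ℤ →* GL (Fin 2) ℤ)
    (ha : a (Multiplicative.ofAdd 1) = Sgl) (hb : b (Multiplicative.ofAdd 1) = Tgl) :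
    Function.Injective (Monoid.CoprodI.lift (hom a b)) := by
  apply Monoid.CoprodI.lift_injective_of_ping_pong (hom a b) ?_ X
  · rintro (_ | _)
    · exact ⟨Sgl, by simp [X, Sgl]⟩
    · exact ⟨1, by simp [X]⟩
  · rintro (_ | _) (_ | _) hij
    · exact absurd rfl hij
    · exact Set.disjoint_left.2 fun g h1 h2 => lt_asymm (α := ℤ) h1 h2
    · exact Set.disjoint_left.2 fun g h1 h2 => lt_asymm (α := ℤ) h1 h2
    · exact absurd rfl hij
  · rintro (_ | _) (_ | _) hij
    · exact absurd rfl hij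
    · intro h hne
      have key : ∀ z : Multiplicative (ZMod 2), z ≠ 1 → z = Multiplicative.ofAdd 1 := by decide
      have hh : hom a b false h = Sgl := by
        rw [key h hne]; exact ha
      rw [hh]
      rintro _ ⟨g, hg, rfl⟩
      change |g.1 1 0| < |g.1 0 0| at hg
      change |(Sgl.1 * g.1) 0 0| < |(Sgl.1 * g.1) 1 0|
      simpa [Sgl, Matrix.mul_apply, Fin.sum_univ_two] using hg
    · intro h hne
      obtain ⟨n, hn'⟩ : ∃ n : ℤ, h = Multiplicative.ofAdd n :=
        ⟨Multiplicative.toAdd (show Multiplicative ℤ from h), rfl⟩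
      have hn : n ≠ 0 := by
        intro h0
        apply hne
        rw [hn', h0]
        rfl
      have hh : hom a b true h = Tgl ^ n := by
        rw [hn', ← hb, ← map_zpow, ← ofAdd_zsmul]
        simp [hom]
      rw [hh]
      rintro _ ⟨g, hg, rfl⟩
      change |g.1 0 0| < |g.1 1 0| at hg
      change |((Tgl ^ n : GL (Fin 2) ℤ).1 * g.1) 1 0| < |((Tgl ^ n : GL (Fin 2) ℤ).1 * g.1) 0 0|
      rw [Tpow]
      simpa [Matrix.mul_apply, Fin.sum_univ_two] using arith n _ _ hn hg
    · exact absurd rfl hij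
  · right
    refine ⟨true, ?_⟩
    have : Infinite (Fam true) := inferInstanceAs (Infinite (Multiplicative ℤ))
    exact (Cardinal.natCast_lt_aleph0 (n := 3)).le.trans (Cardinal.aleph0_le_mk _)

end PP

theorem stmt_1 (hS2 : Sgl * Sgl = 1)
    (f : Monoid.Coprod (Multiplicative (ZMod 2)) (Multiplicative ℤ) →* GL (Fin 2) ℤ)
    (hfS : f (Monoid.Coprod.inl (Multiplicative.ofAdd (1 : ZMod 2))) = Sgl)
    (hfT : f (Monoid.Coprod.inr (Multiplicative.ofAdd (1 : ℤ))) = Tgl) :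
    Function.Injective f := by
  have h := (PP.lift_inj (f.comp Monoid.Coprod.inl) (f.comp Monoid.Coprod.inr) hfS hfT).comp
    PP.cmp_injective
  have e : f = (Monoid.CoprodI.lift (PP.hom (f.comp Monoid.Coprod.inl)
      (f.comp Monoid.Coprod.inr))).comp PP.cmp := by
    apply Monoid.Coprod.hom_ext
    · apply MonoidHom.ext
      intro x
      exact (Monoid.CoprodI.lift_of (M := PP.Fam)
        (PP.hom (f.comp Monoid.Coprod.inl) (f.comp Monoid.Coprod.inr)) (i := false) x).symm
    · apply MonoidHom.ext
      intro x
      exact (Monoid.CoprodI.lift_of (M := PP.Fam)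
        (PP.hom (f.comp Monoid.Coprod.inl) (f.comp Monoid.Coprod.inr)) (i := true) x).symm
  rw [e]
  exact h
end

section
/- Let s = !![-1,0,0; 0,0,1; 0,1,0] and t = !![1,0,0; 0,1,2; 0,0,1], which are 3×3 integer matrices of determinant 1 (elements of SL(3,ℤ)), with s² = 1. Then the group homomorphism from the free product (ℤ/2ℤ) ∗ ℤ to SL(3,ℤ) determined by sending the generator of ℤ/2ℤ to s and the generator 1 ∈ ℤ to t is injective. In particular, SL(3,ℤ) contains a subgroup isomorphic to ℤ ∗ (ℤ/2ℤ). -/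
open Matrix

/-- The matrix `s = !![-1,0,0; 0,0,1; 0,1,0]` as an element of `SL(3,ℤ)`; it satisfies `s² = 1`. -/
def sSL : Matrix.SpecialLinearGroup (Fin 3) ℤ :=
  ⟨!![-1, 0, 0; 0, 0, 1; 0, 1, 0], by decide⟩

/-- The matrix `t = !![1,0,0; 0,1,2; 0,0,1]` as an element of `SL(3,ℤ)`. -/
def tSL : Matrix.SpecialLinearGroup (Fin 3) ℤ :=
  ⟨!![1, 0, 0; 0, 1, 2; 0, 0, 1], by decide⟩

/-- The powers of `t`. -/
def tauHom : Multiplicative ℤ →* Matrix.SpecialLinearGroup (Fin 3) ℤ where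
  toFun n := ⟨!![1, 0, 0; 0, 1, 2 * n.toAdd; 0, 0, 1], by simp [Matrix.det_fin_three]⟩
  map_one' := by
    ext i j
    fin_cases i <;> fin_cases j <;> simp
  map_mul' m n := by
    apply Subtype.ext
    change !![1, 0, 0; 0, 1, 2 * (m.toAdd + n.toAdd); 0, 0, 1] =
      !![1, 0, 0; 0, 1, 2 * m.toAdd; 0, 0, 1] * !![1, 0, 0; 0, 1, 2 * n.toAdd; 0, 0, 1]
    ext i j
    fin_cases i <;> fin_cases j <;> simp [Matrix.mul_apply, Fin.sum_univ_three]
    ring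

/-- The free product. -/
abbrev FP := Monoid.Coprod (Multiplicative (ZMod 2)) (Multiplicative ℤ)

/-- The generator of order two. -/
def gS : FP := Monoid.Coprod.inl (Multiplicative.ofAdd (1 : ZMod 2))

/-- The powers of the free generator. -/
def gT (n : ℤ) : FP := Monoid.Coprod.inr (Multiplicative.ofAdd n)

lemma gS_mul : gS * gS = 1 := by
  unfold gS
  rw [← map_mul, ← map_one Monoid.Coprod.inl]
  rfl

lemma gS_mul_cancel (x : FP) : gS * (gS * x) = x := by
  rw [← mul_assoc, gS_mul, one_mul]

lemma gT_mul (m n : ℤ) : gT m * gT n = gT (m + n) := by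
  unfold gT
  rw [← map_mul, ofAdd_add]

lemma gT_zero : gT 0 = 1 := by
  unfold gT
  rw [ofAdd_zero, map_one]

/-- Reduced words that begin with a power of `t`. -/
inductive Red : FP → Prop
  | t1 (n : ℤ) (hn : n ≠ 0) : Red (gT n)
  | ts (n : ℤ) (hn : n ≠ 0) : Red (gT n * gS)
  | step (n : ℤ) (hn : n ≠ 0) (y : FP) (hy : Red y) : Red (gT n * (gS * y))

/-- Normal forms. -/
def NF (x : FP) : Prop := x = 1 ∨ x = gS ∨ Red x ∨ ∃ y, Red y ∧ x = gS * y

lemma NF.mulS {x : FP} (h : NF x) : NF (gS * x) := by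
  rcases h with rfl | rfl | h | ⟨y, hy, rfl⟩
  · exact Or.inr (Or.inl (mul_one _))
  · exact Or.inl gS_mul
  · exact Or.inr (Or.inr (Or.inr ⟨x, h, rfl⟩))
  · rw [gS_mul_cancel]
    exact Or.inr (Or.inr (Or.inl hy))

lemma NF.mulT {x : FP} (h : NF x) (m : ℤ) : NF (gT m * x) := by
  by_cases hm : m = 0
  · subst hm
    rwa [gT_zero, one_mul]
  rcases h with rfl | rfl | h | ⟨y, hy, rfl⟩
  · rw [mul_one]
    exact Or.inr (Or.inr (Or.inl (.t1 m hm)))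
  · exact Or.inr (Or.inr (Or.inl (.ts m hm)))
  · cases h with
    | t1 n hn =>
      rw [gT_mul]
      by_cases h0 : m + n = 0
      · rw [h0, gT_zero]; exact Or.inl rfl
      · exact Or.inr (Or.inr (Or.inl (.t1 _ h0)))
    | ts n hn =>
      rw [← mul_assoc, gT_mul]
      by_cases h0 : m + n = 0
      · rw [h0, gT_zero, one_mul]; exact Or.inr (Or.inl rfl)
      · exact Or.inr (Or.inr (Or.inl (.ts _ h0)))
    | step n hn y hy =>
      rw [← mul_assoc, gT_mul]
      by_cases h0 : m + n = 0
      · rw [h0, gT_zero, one_mul]; exact Or.inr (Or.inr (Or.inr ⟨y, hy, rfl⟩))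
      · exact Or.inr (Or.inr (Or.inl (.step _ h0 y hy)))
  · exact Or.inr (Or.inr (Or.inl (.step m hm y hy)))

lemma NF.all (x : FP) : NF x := by
  induction x using Monoid.Coprod.induction_on' with
  | one => exact Or.inl rfl
  | inl_mul m x ih =>
    have : m = 1 ∨ m = Multiplicative.ofAdd (1 : ZMod 2) := by
      revert m; decide
    rcases this with rfl | rfl
    · rwa [map_one, one_mul]
    · exact ih.mulS
  | inr_mul n x ih => exact ih.mulT n.toAdd

lemma abs_step (n b c : ℤ) (hn : n ≠ 0) (h : |c| < |b|) : |b| < |c + 2 * n * b| := by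
  have h1 : |2 * n * b| ≤ |c + 2 * n * b| + |c| := by
    have := abs_sub (c + 2 * n * b) c
    simpa using this
  have h2 : |2 * n * b| = 2 * (|n| * |b|) := by
    rw [abs_mul, abs_mul]; simp [mul_assoc]
  have h3 : 1 ≤ |n| := Int.one_le_abs hn
  nlinarith [abs_nonneg b]

lemma sSL_mulVec (v : Fin 3 → ℤ) : sSL.1 *ᵥ v = ![-v 0, v 2, v 1] := by
  ext i
  fin_cases i <;> simp [sSL, Matrix.mulVec, dotProduct, Fin.sum_univ_three]

lemma tau_mulVec (n : ℤ) (v : Fin 3 → ℤ) :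
    (tauHom (Multiplicative.ofAdd n)).1 *ᵥ v = ![v 0, v 1 + 2 * n * v 2, v 2] := by
  change !![1, 0, 0; 0, 1, 2 * n; 0, 0, 1] *ᵥ v = _
  ext i
  fin_cases i <;> simp [ Matrix.mulVec, dotProduct, Fin.sum_univ_three]

lemma Red.grow (f : FP →* Matrix.SpecialLinearGroup (Fin 3) ℤ) (hS : f gS = sSL)
    (hT : ∀ n, f (gT n) = tauHom (Multiplicative.ofAdd n)) {x : FP} (h : Red x) :
    ∃ v : Fin 3 → ℤ, |v 1| + |v 2| = 1 ∧ |((f x).1 *ᵥ v) 2| < |((f x).1 *ᵥ v) 1| ∧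
      1 < |((f x).1 *ᵥ v) 1| + |((f x).1 *ᵥ v) 2| := by
  induction h with
  | t1 n hn =>
    refine ⟨![0, 0, 1], by simp, ?_⟩
    rw [hT, tau_mulVec]
    have := abs_step n 1 0 hn (by simp)
    simp at this ⊢
    omega
  | ts n hn =>
    refine ⟨![0, 1, 0], by simp, ?_⟩
    rw [map_mul, hT, hS, Matrix.SpecialLinearGroup.coe_mul, ← Matrix.mulVec_mulVec,
      tau_mulVec, sSL_mulVec]
    have := abs_step n 1 0 hn (by simp)
    simp at this ⊢
    omega
  | step n hn y hy ih =>
    obtain ⟨v, hv, h1, h2⟩ := ih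
    refine ⟨v, hv, ?_⟩
    rw [map_mul, map_mul, hT, hS, Matrix.SpecialLinearGroup.coe_mul,
      Matrix.SpecialLinearGroup.coe_mul, ← Matrix.mulVec_mulVec, ← Matrix.mulVec_mulVec,
      tau_mulVec, sSL_mulVec]
    have := abs_step n _ _ hn h1
    simp only [Matrix.cons_val] at this ⊢
    omega

theorem stmt_2 (hs2 : sSL * sSL = 1)
    (f : Monoid.Coprod (Multiplicative (ZMod 2)) (Multiplicative ℤ) →*
      Matrix.SpecialLinearGroup (Fin 3) ℤ)
    (hfs : f (Monoid.Coprod.inl (Multiplicative.ofAdd (1 : ZMod 2))) = sSL)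
    (hft : f (Monoid.Coprod.inr (Multiplicative.ofAdd (1 : ℤ))) = tSL) :
    Function.Injective f := by
  have hS : f gS = sSL := hfs
  have hcomp : f.comp Monoid.Coprod.inr = tauHom := by
    apply MonoidHom.ext_mint
    rw [MonoidHom.comp_apply, hft]
    rfl
  have hT : ∀ n, f (gT n) = tauHom (Multiplicative.ofAdd n) := fun n =>
    DFunLike.congr_fun hcomp (Multiplicative.ofAdd n)
  rw [injective_iff_map_eq_one]
  intro x hx
  rcases NF.all x with h | rfl | h | ⟨y, hy, rfl⟩
  · exact h
  · rw [hS] at hx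
    exact absurd hx (by decide)
  · obtain ⟨v, hv, h1, h2⟩ := h.grow f hS hT
    rw [hx] at h2
    simp at h2
    omega
  · obtain ⟨v, hv, h1, h2⟩ := hy.grow f hS hT
    have h3 : (f (gS * y)).1 *ᵥ v = v := by rw [hx]; simp
    rw [map_mul, hS, Matrix.SpecialLinearGroup.coe_mul, ← Matrix.mulVec_mulVec,
      sSL_mulVec] at h3
    have e1 := congrFun h3 1
    have e2 := congrFun h3 2
    simp only [Matrix.cons_val] at e1 e2
    rw [e1, e2] at h2
    omega
end

section
/- For every natural number n ≥ 2, the projective special linear group PSL(n,ℤ), i.e., the quotient of SL(n,ℤ) by its center, contains a subgroup isomorphic to ℤ ∗ (ℤ/2ℤ). Equivalently, there exists an injective group homomorphism from the free product ℤ ∗ (ℤ/2ℤ) into the quotient group SL(n,ℤ) / Z(SL(n,ℤ)). -/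
open scoped Pointwise in
/-- Ping-pong criterion for embedding `ℤ ∗ ℤ/2` into a group `G` acting on `α`. -/
theorem exists_injective_of_pingpong {G α : Type} [Group G] (φ : G →* Equiv.Perm α)
    (a u : G) (hu : u ^ 2 = 1) (A B : Set α) (hA : A.Nonempty) (hB : B.Nonempty)
    (hAB : Disjoint A B)
    (h1 : ∀ m : ℤ, m ≠ 0 → ∀ x ∈ B, φ (a ^ m) x ∈ A)
    (h2 : ∀ x ∈ A, φ u x ∈ B) :
    ∃ f : Monoid.Coprod (Multiplicative ℤ) (Multiplicative (ZMod 2)) →* G,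
      Function.Injective f := by
  let _ : MulAction G α := MulAction.compHom α φ
  let H : Bool → Type := fun b => Multiplicative (ZMod (cond b 2 0))
  let _ : ∀ b, Group (H b) := fun b =>
    inferInstanceAs (Group (Multiplicative (ZMod (cond b 2 0))))
  let g : Multiplicative (ZMod 2) →* G :=
    AddMonoidHom.toMultiplicativeLeft (ZMod.lift 2
      ⟨zmultiplesHom (Additive G) (Additive.ofMul u), by
        simp only [zmultiplesHom_apply]
        rw [← ofMul_zpow]
        exact congrArg Additive.ofMul (by exact_mod_cast hu)⟩)
  have hg : ∀ x, x ≠ 1 → g x = u := by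
    intro x hx
    have hx1 : x = Multiplicative.ofAdd ((1 : ℤ) : ZMod 2) := by
      revert x; decide
    subst hx1
    change Additive.toMul (ZMod.lift 2 _ ((1 : ℤ) : ZMod 2)) = u
    rw [ZMod.lift_coe]
    simp
  let F : ∀ b, H b →* G := fun b => match b with
    | false => (zpowersHom G a : Multiplicative ℤ →* G)
    | true => g
  let X : Bool → Set α := fun b => cond b B A
  have key : Function.Injective (Monoid.CoprodI.lift F) := by
    refine Monoid.CoprodI.lift_injective_of_ping_pong F ?_ X ?_ ?_ ?_
    · right
      refine ⟨false, ?_⟩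
      have : Infinite (H false) := inferInstanceAs (Infinite (Multiplicative ℤ))
      exact (Cardinal.natCast_le_aleph0 (n := 3)).trans (Cardinal.aleph0_le_mk _)
    · rintro (_ | _)
      exacts [hA, hB]
    · rintro (_ | _) (_ | _) hij
      · exact absurd rfl hij
      · exact hAB
      · exact hAB.symm
      · exact absurd rfl hij
    · rintro (_ | _) (_ | _) hij h hh
      · exact absurd rfl hij
      · rintro _ ⟨x, hx, rfl⟩
        exact h1 (Multiplicative.toAdd (h : Multiplicative ℤ)) (fun h0 => hh h0) x hx
      · rintro _ ⟨x, hx, rfl⟩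
        have : F true h = u := hg h hh
        change φ (F true h) x ∈ B
        rw [this]
        exact h2 x hx
      · exact absurd rfl hij
  let i1 : Multiplicative ℤ →* Monoid.CoprodI H := Monoid.CoprodI.of (M := H) (i := false)
  let i2 : Multiplicative (ZMod 2) →* Monoid.CoprodI H := Monoid.CoprodI.of (M := H) (i := true)
  let J : ∀ b, H b →* Monoid.Coprod (Multiplicative ℤ) (Multiplicative (ZMod 2)) :=
    fun b => match b with
    | false => (Monoid.Coprod.inl : Multiplicative ℤ →* _)
    | true => (Monoid.Coprod.inr : Multiplicative (ZMod 2) →* _)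
  have hinv : (Monoid.CoprodI.lift J).comp (Monoid.Coprod.lift i1 i2) = MonoidHom.id _ := by
    apply Monoid.Coprod.hom_ext
    · refine MonoidHom.ext fun x => ?_
      exact Monoid.CoprodI.lift_of (M := H) (i := false) J x
    · refine MonoidHom.ext fun x => ?_
      exact Monoid.CoprodI.lift_of (M := H) (i := true) J x
  refine ⟨(Monoid.CoprodI.lift F).comp (Monoid.Coprod.lift i1 i2), ?_⟩
  refine key.comp ?_
  exact Function.LeftInverse.injective (g := Monoid.CoprodI.lift J) fun x => DFunLike.congr_fun hinv x

open Matrix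

/-- The congruence action `A ↦ g A gᵀ` of `SL(n,ℤ)` on integer matrices. -/
def congAct (n : ℕ) : SpecialLinearGroup (Fin n) ℤ →* Equiv.Perm (Matrix (Fin n) (Fin n) ℤ) :=
  letI : MulAction (SpecialLinearGroup (Fin n) ℤ) (Matrix (Fin n) (Fin n) ℤ) :=
    { smul := fun g A => g.1 * A * g.1ᵀ
      one_smul := fun A => by
        change (1 : Matrix (Fin n) (Fin n) ℤ) * A * (1 : Matrix (Fin n) (Fin n) ℤ)ᵀ = A
        simp
      mul_smul := fun g h A => by
        change (g.1 * h.1) * A * (g.1 * h.1)ᵀ = g.1 * (h.1 * A * h.1ᵀ) * g.1ᵀ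
        simp [Matrix.transpose_mul, Matrix.mul_assoc] }
  MulAction.toPermHom _ _

theorem congAct_apply (n : ℕ) (g : SpecialLinearGroup (Fin n) ℤ) (A) :
    congAct n g A = g.1 * A * g.1ᵀ := rfl

theorem congAct_vec (n : ℕ) (g : SpecialLinearGroup (Fin n) ℤ) (v : Fin n → ℤ) :
    congAct n g (vecMulVec v v) = vecMulVec (g.1 *ᵥ v) (g.1 *ᵥ v) := by
  rw [congAct_apply, mul_vecMulVec, vecMulVec_mul, vecMul_transpose]

theorem center_le_ker (n : ℕ) (hn : 2 ≤ n) :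
    Subgroup.center (SpecialLinearGroup (Fin n) ℤ) ≤ (congAct n).ker := by
  intro g hg
  obtain ⟨r, hr, hg⟩ := Matrix.SpecialLinearGroup.mem_center_iff.1 hg
  have hr2 : r * r = 1 := by
    have : IsUnit r := IsUnit.of_pow_eq_one hr (by simp; omega)
    rcases Int.isUnit_iff.1 this with h | h <;> simp [h]
  rw [MonoidHom.mem_ker]
  ext1 A
  rw [congAct_apply, ← hg]
  simp only [scalar_apply, diagonal_transpose]
  ext i j
  rw [mul_diagonal, diagonal_mul, mul_right_comm, hr2]
  simp

theorem exists_s (k : ℕ) : ∃ s : SpecialLinearGroup (Fin (k + 2)) ℤ,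
    s ^ 2 ∈ Subgroup.center (SpecialLinearGroup (Fin (k + 2)) ℤ) ∧
    ∀ v : Fin (k + 2) → ℤ, |(s.1 *ᵥ v) 0| = |v 1| ∧ |(s.1 *ᵥ v) 1| = |v 0| := by
  let d : Fin (k + 2) → ℤ := fun i => if i = Fin.last _ then -1 else 1
  let σ : Equiv.Perm (Fin (k + 2)) := Equiv.swap 0 1
  have hdet : (diagonal d * σ.permMatrix ℤ).det = 1 := by
    rw [det_mul, det_permutation, det_diagonal, Equiv.Perm.sign_swap (by simp)]
    simp [d, Finset.prod_ite_eq']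
  have hd : ∀ i, |d i| = 1 := by intro i; simp only [d]; split_ifs <;> simp
  have hv : ∀ (v : Fin (k + 2) → ℤ) i, ((diagonal d * σ.permMatrix ℤ) *ᵥ v) i = d i * v (σ i) := by
    intro v i
    rw [← mulVec_mulVec, mulVec_diagonal, permMatrix_mulVec]
    rfl
  refine ⟨⟨_, hdet⟩, ?_, ?_⟩
  · refine Matrix.SpecialLinearGroup.mem_center_iff.2 ?_
    have hsq : ∃ r : ℤ, |r| = 1 ∧ r ^ (k + 2) = 1 ∧ ∀ i, d i * d (σ i) = r := by
      rcases k with _ | k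
      · refine ⟨-1, by simp, by simp, ?_⟩
        intro i
        fin_cases i <;> simp [d, σ, Fin.last]
      · refine ⟨1, by simp, by simp, ?_⟩
        intro i
        have h : σ i = Fin.last _ ↔ i = Fin.last _ := by
          have h0 : σ (Fin.last _) = Fin.last (k + 1 + 1) :=
            Equiv.swap_apply_of_ne_of_ne (by simp [Fin.ext_iff]) (by simp [Fin.ext_iff])
          constructor
          · intro h; exact σ.injective (h.trans h0.symm)
          · rintro rfl; exact h0
        simp only [d, h]
        split_ifs <;> simp
    obtain ⟨r, -, hr, hr2⟩ := hsq
    refine ⟨r, by simpa using hr, ?_⟩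
    change scalar _ r = (diagonal d * σ.permMatrix ℤ) ^ 2
    rw [← Matrix.mulVec_injective.eq_iff]
    funext v i
    rw [pow_two, ← mulVec_mulVec, hv, hv, ← mul_assoc, hr2]
    simp [scalar_apply, mulVec_diagonal, σ]
  · intro v
    simp only [hv, abs_mul, hd, one_mul]
    simp [σ]

theorem stmt_3 (n : ℕ) (hn : 2 ≤ n) :
    ∃ f : Monoid.Coprod (Multiplicative ℤ) (Multiplicative (ZMod 2)) →*
        (Matrix.SpecialLinearGroup (Fin n) ℤ ⧸
          Subgroup.center (Matrix.SpecialLinearGroup (Fin n) ℤ)),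
      Function.Injective f := by
  obtain ⟨k, rfl⟩ : ∃ k, n = k + 2 := ⟨n - 2, by omega⟩
  obtain ⟨s, hs, hsv⟩ := exists_s k
  have h01 : (0 : Fin (k + 2)) ≠ 1 := by simp
  let t : SpecialLinearGroup (Fin (k + 2)) ℤ := SpecialLinearGroup.transvection h01 2
  have ht : ∀ m : ℤ, t ^ m = SpecialLinearGroup.transvection h01 (2 * m) := by
    have hmul : ∀ b c : ℤ, SpecialLinearGroup.transvection h01 b *
        SpecialLinearGroup.transvection h01 c = SpecialLinearGroup.transvection h01 (b + c) := by
      intro b c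
      apply Subtype.ext
      exact transvection_mul_transvection_same _ _ h01 b c
    intro m
    induction m using Int.induction_on with
    | zero => simp
    | succ i ih => rw [_root_.zpow_add_one, ih, hmul]; congr 1
    | pred i ih =>
      rw [_root_.zpow_sub_one, ih, mul_inv_eq_iff_eq_mul, hmul]; congr 1; ring
  have htv : ∀ (m : ℤ) (v : Fin (k + 2) → ℤ), ((t ^ m).1 *ᵥ v) 0 = v 0 + 2 * m * v 1 ∧
      ((t ^ m).1 *ᵥ v) 1 = v 1 := by
    intro m v
    rw [ht]
    change ((1 + single 0 1 (2 * m)) *ᵥ v) 0 = _ ∧ ((1 + single 0 1 (2 * m)) *ᵥ v) 1 = _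
    simp [add_mulVec, single_mulVec]
  refine exists_injective_of_pingpong
    (QuotientGroup.lift _ (congAct (k + 2)) (center_le_ker _ hn))
    (QuotientGroup.mk t) (QuotientGroup.mk s) ?_
    {A | ∃ v : Fin (k + 2) → ℤ, A = vecMulVec v v ∧ |v 1| < |v 0|}
    {A | ∃ v : Fin (k + 2) → ℤ, A = vecMulVec v v ∧ |v 0| < |v 1|} ?_ ?_ ?_ ?_ ?_
  · rw [← QuotientGroup.mk_pow]
    exact (QuotientGroup.eq_one_iff _).2 hs
  · exact ⟨_, Pi.single 0 1, rfl, by simp⟩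
  · exact ⟨_, Pi.single 1 1, rfl, by simp⟩
  · rw [Set.disjoint_left]
    rintro A ⟨v, rfl, hv⟩ ⟨w, hw, hw2⟩
    have e0 := congrFun (congrFun hw 0) 0
    have e1 := congrFun (congrFun hw 1) 1
    simp only [vecMulVec_apply] at e0 e1
    rw [← sq_lt_sq] at hv hw2
    nlinarith
  · rintro m hm _ ⟨v, rfl, hv⟩
    rw [← QuotientGroup.mk_zpow, QuotientGroup.lift_mk, congAct_vec]
    refine ⟨_, rfl, ?_⟩
    rw [(htv m v).1, (htv m v).2]
    have h1 : |2 * m * v 1| ≤ |v 0 + 2 * m * v 1| + |v 0| := by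
      have := abs_sub (v 0 + 2 * m * v 1) (v 0)
      simpa using this
    have h2 : |2 * m * v 1| = 2 * |m| * |v 1| := by simp [abs_mul]
    have h3 : 1 ≤ |m| := Int.one_le_abs hm
    nlinarith [abs_nonneg (v 1)]
  · rintro _ ⟨v, rfl, hv⟩
    rw [QuotientGroup.lift_mk, congAct_vec]
    refine ⟨_, rfl, ?_⟩
    rwa [(hsv v).1, (hsv v).2]
end

section
/- Let α be a type with two distinct elements i₀ and i₁, let G = FreeGroup α be the free group on α, and write x_i = FreeGroup.of i for the free generators. Then for every finite subset F ⊆ G with 1 ∉ F and every finite subset F' ⊆ G, there exists s ∈ G such that for all f ∈ F, all g, h ∈ F', and all m ∈ ℤ, one has s * f * s⁻¹ ≠ g * x_{i₀}^m * h. That is, sFs⁻¹ is disjoint from F'·⟨x_{i₀}⟩·F', where ⟨x_{i₀}⟩ is the cyclic subgroup generated by x_{i₀}. -/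
def GoodWord {α : Type*} (i : α) (l : List (α × Bool)) : Prop :=
  FreeGroup.IsReduced l ∧ l ≠ [] ∧ (∀ x ∈ l.head?, x.1 ≠ i) ∧ (∀ x ∈ l.getLast?, x.1 ≠ i)

def powWord {α : Type*} (i : α) (n : ℤ) : List (α × Bool) :=
  List.replicate n.natAbs (i, decide (0 ≤ n))

theorem mk_powWord {α : Type*} (i : α) (n : ℤ) :
    FreeGroup.mk (powWord i n) = FreeGroup.of i ^ n := by
  have key : ∀ (k : ℕ) (e : Bool),
      FreeGroup.mk (List.replicate k (i, e)) = (FreeGroup.mk [(i, e)]) ^ k := by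
    intro k e
    induction k with
    | zero => rfl
    | succ k ih => rw [pow_succ', ← ih, FreeGroup.mul_mk]; rfl
  have hinv : FreeGroup.mk [(i, false)] = (FreeGroup.of i)⁻¹ := rfl
  have hof : FreeGroup.mk [(i, true)] = (FreeGroup.of i) := rfl
  unfold powWord
  rw [key]
  rcases le_or_gt 0 n with h | h
  · lift n to ℕ using h
    simp [hof]
  · obtain ⟨k, rfl⟩ : ∃ k : ℕ, n = -(k : ℤ) := ⟨n.natAbs, by omega⟩
    have : ¬ (0 : ℤ) ≤ -(k : ℤ) := by omega
    rw [decide_eq_false this, hinv]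
    simp

theorem isReduced_powWord {α : Type*} (i : α) (n : ℤ) : FreeGroup.IsReduced (powWord i n) :=
  List.isChain_replicate_of_rel _ (fun _ => rfl)

theorem mem_powWord {α : Type*} {i : α} {n : ℤ} {x : α × Bool} (h : x ∈ powWord i n) :
    x.1 = i := by
  rw [List.eq_of_mem_replicate h]

theorem sandwich {α : Type*} {i : α} {l : List (α × Bool)} (h : GoodWord i l) (p q : ℤ) :
    FreeGroup.IsReduced (powWord i p ++ l ++ powWord i q) := by
  obtain ⟨h1, h2, h3, h4⟩ := h
  refine FreeGroup.IsReduced.append_overlap ?_ ?_ h2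
  · refine List.isChain_append.2 ⟨isReduced_powWord _ _, h1, ?_⟩
    intro x hx y hy hxy
    exact absurd (hxy ▸ mem_powWord (List.mem_of_getLast? hx)) (h3 y hy)
  · refine List.isChain_append.2 ⟨h1, isReduced_powWord _ _, ?_⟩
    intro x hx y hy hxy
    exact absurd (hxy.trans (mem_powWord (List.mem_of_head? hy))) (h4 x hx)

theorem decomp {α : Type*} (i : α) (n : ℕ) : ∀ l : List (α × Bool), l.length = n →
    FreeGroup.IsReduced l → ∃ (p q : ℤ) (l' : List (α × Bool)), (l' = [] ∨ GoodWord i l') ∧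
      FreeGroup.mk l = FreeGroup.of i ^ p * FreeGroup.mk l' * FreeGroup.of i ^ q := by
  have hs : ∀ e : Bool, ∃ r : ℤ, FreeGroup.mk [(i, e)] = FreeGroup.of i ^ r := by
    intro e
    cases e
    · exact ⟨-1, by rw [zpow_neg_one]; rfl⟩
    · exact ⟨1, by rw [zpow_one]; rfl⟩
  induction n with
  | zero =>
    intro l hl _
    exact ⟨0, 0, [], Or.inl rfl, by simp [List.length_eq_zero_iff.1 hl]⟩
  | succ n ih =>
    intro l hl hr
    by_cases h3 : ∀ x ∈ l.head?, x.1 ≠ i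
    · by_cases h4 : ∀ x ∈ l.getLast?, x.1 ≠ i
      · exact ⟨0, 0, l, Or.inr ⟨hr, by rintro rfl; simp at hl, h3, h4⟩, by simp⟩
      · push Not at h4
        obtain ⟨⟨a, e⟩, hx, rfl⟩ := h4
        obtain ⟨t, rfl⟩ := List.mem_getLast?_eq_getLast hx |> fun ⟨h, h'⟩ =>
          (⟨l.dropLast, by rw [h']; exact (List.dropLast_append_getLast h).symm⟩ :
            ∃ t, l = t ++ [(a, e)])
        obtain ⟨p, q, l', h', he⟩ := ih t (by simpa using hl) (hr.infix ⟨[], [(a, e)], by simp⟩)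
        obtain ⟨r, hr'⟩ := hs e
        refine ⟨p, q + r, l', h', ?_⟩
        rw [← FreeGroup.mul_mk, he, hr', zpow_add]
        simp only [mul_assoc]
    · push Not at h3
      obtain ⟨⟨a, e⟩, hx, rfl⟩ := h3
      cases l with
      | nil => simp at hx
      | cons y t =>
        obtain rfl : y = (a, e) := by simpa using hx
        obtain ⟨p, q, l', h', he⟩ := ih t (by simpa using hl) (hr.infix ⟨[(a, e)], [], by simp⟩)
        obtain ⟨r, hr'⟩ := hs e
        refine ⟨r + p, q, l', h', ?_⟩
        have : FreeGroup.mk ((a, e) :: t) = FreeGroup.mk [(a, e)] * FreeGroup.mk t := by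
          rw [FreeGroup.mul_mk]; rfl
        rw [this, he, hr', zpow_add]
        simp only [mul_assoc]

theorem good_powWord {α : Type*} {i j : α} (hne : i ≠ j) {k : ℤ} (hk : k ≠ 0) :
    GoodWord j (powWord i k) := by
  refine ⟨isReduced_powWord _ _, by simpa [powWord] using hk, ?_, ?_⟩
  · intro x hx
    rw [mem_powWord (List.mem_of_head? hx)]; exact hne
  · intro x hx
    rw [mem_powWord (List.mem_of_getLast? hx)]; exact hne

theorem good_sandwich {α : Type*} {i j : α} (hne : i ≠ j) {l : List (α × Bool)}
    (h : GoodWord i l) {p q : ℤ} (hp : p ≠ 0) (hq : q ≠ 0) :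
    GoodWord j (powWord i p ++ l ++ powWord i q) := by
  have h1 := good_powWord hne hp
  have h2 := good_powWord hne hq
  refine ⟨sandwich h p q, by simp [h.2.1], ?_, ?_⟩
  · intro x hx
    rw [List.append_assoc, List.head?_append_of_ne_nil _ h1.2.1] at hx
    exact h1.2.2.1 x hx
  · intro x hx
    rw [List.getLast?_append_of_ne_nil _ h2.2.1] at hx
    exact h2.2.2.2 x hx

theorem eventually_good {α : Type*} {i j : α} (hne : i ≠ j) (f : FreeGroup α) (hf : f ≠ 1) :
    ∀ᶠ M : ℕ in Filter.atTop, ∃ l, GoodWord j l ∧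
      FreeGroup.of i ^ (M : ℤ) * f * FreeGroup.of i ^ (-(M : ℤ)) = FreeGroup.mk l := by
  classical
  obtain ⟨p, q, l', h', he⟩ := decomp i _ f.toWord rfl FreeGroup.isReduced_toWord
  rw [FreeGroup.mk_toWord] at he
  filter_upwards [Filter.eventually_gt_atTop (p.natAbs + q.natAbs)] with M hM
  rcases h' with rfl | h'
  · have hf' : f = FreeGroup.of i ^ (p + q) := by
      rw [he, ← FreeGroup.one_eq_mk, mul_one, zpow_add]
    refine ⟨powWord i (p + q), good_powWord hne ?_, ?_⟩
    · intro h0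
      rw [h0, zpow_zero] at hf'
      exact hf hf'
    · rw [mk_powWord, hf', ← zpow_add, ← zpow_add]
      congr 1; ring
  · refine ⟨_, good_sandwich hne h' (p := M + p) (q := q - M) (by omega) (by omega), ?_⟩
    rw [← FreeGroup.mul_mk, ← FreeGroup.mul_mk, mk_powWord, mk_powWord, he, zpow_add,
      sub_eq_add_neg, zpow_add]
    simp only [mul_assoc]

theorem stmt_4 {α : Type*} (i₀ i₁ : α) (hne : i₀ ≠ i₁)
    (F F' : Finset (FreeGroup α)) (hF : (1 : FreeGroup α) ∉ F) :
    ∃ s : FreeGroup α, ∀ f ∈ F, ∀ g ∈ F', ∀ h ∈ F', ∀ m : ℤ,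
      s * f * s⁻¹ ≠ g * (FreeGroup.of i₀) ^ m * h := by
  classical
  have hev : ∀ᶠ M : ℕ in Filter.atTop, ∀ f ∈ F, ∃ l, GoodWord i₁ l ∧
      FreeGroup.of i₀ ^ (M : ℤ) * f * FreeGroup.of i₀ ^ (-(M : ℤ)) = FreeGroup.mk l := by
    rw [Filter.eventually_all_finset]
    intro f hf
    exact eventually_good hne f (fun h => hF (h ▸ hf))
  obtain ⟨M, hM⟩ := hev.exists
  let c : FreeGroup α → ℕ := fun g => g.toWord.countP (fun x => decide (x.1 = i₁))
  have hc : ∀ g h, c (g * h) ≤ c g + c h := by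
    intro g h
    rw [← List.countP_append]
    exact (FreeGroup.toWord_mul_sublist g h).countP_le
  have hc0 : ∀ m : ℤ, c (FreeGroup.of i₀ ^ m) = 0 := by
    intro m
    simp only [c]
    rw [← mk_powWord, FreeGroup.toWord_mk, (isReduced_powWord _ _).reduce_eq, List.countP_eq_zero]
    intro x hx
    simpa [mem_powWord hx] using hne
  let N : ℕ := F'.sup c
  let B : ℤ := ((2 * N + 1 : ℕ) : ℤ)
  refine ⟨FreeGroup.of i₁ ^ B * FreeGroup.of i₀ ^ (M : ℤ), ?_⟩
  intro f hf g hg h hh m heq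
  obtain ⟨l, hl, hle⟩ := hM f hf
  have e1 : FreeGroup.of i₁ ^ B * FreeGroup.of i₀ ^ (M : ℤ) * f *
      (FreeGroup.of i₁ ^ B * FreeGroup.of i₀ ^ (M : ℤ))⁻¹ =
      FreeGroup.mk (powWord i₁ B ++ l ++ powWord i₁ (-B)) := by
    rw [← FreeGroup.mul_mk, ← FreeGroup.mul_mk, mk_powWord, mk_powWord, ← hle]
    group
  have h1 : 2 * N + 1 ≤ c (FreeGroup.mk (powWord i₁ B ++ l ++ powWord i₁ (-B))) := by
    simp only [c]
    rw [FreeGroup.toWord_mk, (sandwich hl _ _).reduce_eq, List.countP_append, List.countP_append]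
    have : (powWord i₁ B).countP (fun x => decide (x.1 = i₁)) = 2 * N + 1 := by
      rw [List.countP_eq_length.2 (fun x hx => by simpa using mem_powWord hx)]
      simp only [powWord, List.length_replicate, B, Int.natAbs_natCast]
    omega
  rw [← e1, heq] at h1
  have h2 := hc (g * FreeGroup.of i₀ ^ m) h
  have h3 := hc g (FreeGroup.of i₀ ^ m)
  have h4 : c g ≤ N := Finset.le_sup hg
  have h5 : c h ≤ N := Finset.le_sup hh
  rw [hc0] at h3
  omega
end

section
/- Let α be a type with two distinct elements i₀ and i₁, let G = FreeGroup α, and write x_i = FreeGroup.of i. Then for every finite subset F ⊆ G with 1 ∉ F, there exists k ∈ ℕ such that for all f ∈ F and all m ∈ ℤ, one has x_{i₀}^k * f * x_{i₀}^{-k} ≠ x_{i₁}^m. That is, the conjugate set x_{i₀}^k F x_{i₀}^{-k} is disjoint from the cyclic subgroup generated by x_{i₁}. -/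
def shX : Equiv.Perm (ℤ × ℤ) where
  toFun p := (p.1 + p.2, p.2)
  invFun p := (p.1 - p.2, p.2)
  left_inv p := by simp
  right_inv p := by simp

def shY : Equiv.Perm (ℤ × ℤ) where
  toFun p := (p.1, p.2 + p.1)
  invFun p := (p.1, p.2 - p.1)
  left_inv p := by simp
  right_inv p := by simp

lemma shX_pow (d : ℕ) (p : ℤ × ℤ) : (shX ^ d) p = (p.1 + d * p.2, p.2) := by
  induction d with
  | zero => simp
  | succ n ih =>
    rw [pow_succ', Equiv.Perm.mul_apply, ih]
    simp only [shX, Equiv.coe_fn_mk, Prod.mk.injEq, and_true]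
    push_cast; ring

lemma shY_pow (d : ℕ) (p : ℤ × ℤ) : (shY ^ d) p = (p.1, p.2 + d * p.1) := by
  induction d with
  | zero => simp
  | succ n ih =>
    rw [pow_succ', Equiv.Perm.mul_apply, ih]
    simp only [shY, Equiv.coe_fn_mk, Prod.mk.injEq, true_and]
    push_cast; ring

lemma shY_zpow (m : ℤ) (p : ℤ × ℤ) : (shY ^ m) p = (p.1, p.2 + m * p.1) := by
  obtain ⟨n, rfl | rfl⟩ := m.eq_nat_or_neg
  · rw [zpow_natCast, shY_pow]
  · rw [zpow_neg, zpow_natCast, Equiv.Perm.inv_eq_iff_eq, shY_pow]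
    ext <;> simp

lemma key {α : Type*} (i₀ i₁ : α) (hne : i₀ ≠ i₁) (d : ℕ) (m n : ℤ)
    (h : (FreeGroup.of i₀) ^ d * (FreeGroup.of i₁) ^ m
      = (FreeGroup.of i₁) ^ n * (FreeGroup.of i₀) ^ d) : d = 0 ∨ m = 0 := by
  classical
  have h2 := congrArg (FreeGroup.lift (fun i => if i = i₀ then shX else shY)) h
  simp only [map_mul, map_pow, map_zpow, FreeGroup.lift_apply_of, if_true, if_neg hne.symm] at h2
  have h3 := congrArg (fun e : Equiv.Perm (ℤ × ℤ) => (e (1, 0)).1) h2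
  simpa [Equiv.Perm.mul_apply, shX_pow, shY_zpow] using h3

lemma key2 {α : Type*} (i₀ i₁ : α) (hne : i₀ ≠ i₁) (f : FreeGroup α) (hf : f ≠ 1)
    (k l : ℕ) (hkl : k ≤ l) (m n : ℤ)
    (h1 : (FreeGroup.of i₀) ^ k * f * (FreeGroup.of i₀) ^ (-(k : ℤ)) = (FreeGroup.of i₁) ^ m)
    (h2 : (FreeGroup.of i₀) ^ l * f * (FreeGroup.of i₀) ^ (-(l : ℤ)) = (FreeGroup.of i₁) ^ n) :
    k = l := by
  obtain ⟨d, rfl⟩ := Nat.exists_eq_add_of_le' hkl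
  rw [zpow_neg, zpow_natCast, mul_inv_eq_iff_eq_mul] at h1 h2
  have h := key i₀ i₁ hne d m n (by
    apply mul_right_cancel (b := FreeGroup.of i₀ ^ k)
    rw [mul_assoc, ← h1, mul_assoc, ← pow_add, ← h2, pow_add, mul_assoc])
  rcases h with rfl | rfl
  · simp
  · exact absurd (by simpa using h1) hf

theorem stmt_5 {α : Type*} (i₀ i₁ : α) (hne : i₀ ≠ i₁)
    (F : Finset (FreeGroup α)) (hF : (1 : FreeGroup α) ∉ F) :
    ∃ k : ℕ, ∀ f ∈ F, ∀ m : ℤ,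
      (FreeGroup.of i₀) ^ k * f * (FreeGroup.of i₀) ^ (-(k : ℤ)) ≠ (FreeGroup.of i₁) ^ m := by
  have hfin : (⋃ f ∈ F, {k : ℕ | ∃ m : ℤ, (FreeGroup.of i₀) ^ k * f *
      (FreeGroup.of i₀) ^ (-(k : ℤ)) = (FreeGroup.of i₁) ^ m}).Finite := by
    refine Set.Finite.biUnion F.finite_toSet fun f hf => Set.Subsingleton.finite ?_
    have hf1 : f ≠ 1 := fun h => hF (h ▸ hf)
    rintro k ⟨m, hm⟩ l ⟨n, hn⟩
    rcases le_total k l with h | h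
    · exact key2 i₀ i₁ hne f hf1 k l h m n hm hn
    · exact (key2 i₀ i₁ hne f hf1 l k h n m hn hm).symm
  obtain ⟨k, hk⟩ := hfin.exists_notMem
  refine ⟨k, fun f hf m h => hk ?_⟩
  simp only [Set.mem_iUnion]
  exact ⟨f, hf, m, h⟩
end

section
/- Let Γ be a group and let s, t ∈ Γ be such that the group homomorphism ℤ ∗ (ℤ/2ℤ) → Γ sending the generator 1 ∈ ℤ to s and the generator of ℤ/2ℤ to t is injective (so t² = 1, t ≠ 1, s has infinite order, and the subgroup generated by s and t is isomorphic to ℤ ∗ ℤ/2ℤ). Then for every integer k ≥ 1, in the group algebra ℂ[Γ] (the monoid algebra MonoidAlgebra ℂ Γ) the product (1 + δ_t) * δ_{s^{-k}} * (1 − δ_t) * δ_{s^k} * (1 + δ_t) is nonzero; equivalently, 1 + 2·δ_t − δ_{s^{-k} t s^k} − δ_{s^{-k} t s^k t} − δ_{t s^{-k} t s^k} − δ_{t s^{-k} t s^k t} ≠ 0 in ℂ[Γ]. -/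
theorem stmt_6_aux :
    ∃ g : Monoid.Coprod (Multiplicative ℤ) (Multiplicative (ZMod 2)) →* DihedralGroup 0,
      g (Monoid.Coprod.inl (Multiplicative.ofAdd (1 : ℤ))) = DihedralGroup.r 1 ∧
      g (Monoid.Coprod.inr (Multiplicative.ofAdd (1 : ZMod 2))) = DihedralGroup.sr 0 := by
  let a : ℤ →+ Additive (DihedralGroup 0) :=
    zmultiplesHom _ (Additive.ofMul (DihedralGroup.sr 0))
  have ha : a ((2 : ℕ) : ℤ) = 0 := by
    change DihedralGroup.sr (0 : ZMod 0) ^ (2 : ℤ) = 1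
    rw [zpow_two, DihedralGroup.sr_mul_self]
  refine ⟨Monoid.Coprod.lift (zpowersHom _ (DihedralGroup.r 1))
    (AddMonoidHom.toMultiplicativeLeft (ZMod.lift 2 ⟨a, ha⟩)), ?_, ?_⟩
  · simp
  · have h : ZMod.lift 2 ⟨a, ha⟩ (1 : ZMod 2) = a 1 := by
      simpa using ZMod.lift_coe 2 ⟨a, ha⟩ 1
    simp only [Monoid.Coprod.lift_apply_inr]
    change Additive.toMul (ZMod.lift 2 ⟨a, ha⟩ (1 : ZMod 2)) = _
    rw [h]
    simp [a]

theorem stmt_6 {Γ : Type*} [Group Γ] (s t : Γ)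
    (f : Monoid.Coprod (Multiplicative ℤ) (Multiplicative (ZMod 2)) →* Γ)
    (hf : Function.Injective f)
    (hfs : f (Monoid.Coprod.inl (Multiplicative.ofAdd (1 : ℤ))) = s)
    (hft : f (Monoid.Coprod.inr (Multiplicative.ofAdd (1 : ZMod 2))) = t) :
    ∀ k : ℤ, 1 ≤ k →
      (1 + MonoidAlgebra.of ℂ Γ t) * MonoidAlgebra.of ℂ Γ (s ^ (-k)) *
          (1 - MonoidAlgebra.of ℂ Γ t) * MonoidAlgebra.of ℂ Γ (s ^ k) *
          (1 + MonoidAlgebra.of ℂ Γ t) ≠ 0 := by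
  intro k hk h0
  obtain ⟨g, hg1, hg2⟩ := stmt_6_aux
  have hc : s ^ k * t ≠ t * s ^ k := by
    intro h
    rw [← hfs, ← hft, ← map_zpow, ← map_mul, ← map_mul] at h
    have h2 := congrArg g (hf h)
    rw [map_mul, map_mul, map_zpow, hg1, hg2, DihedralGroup.r_one_zpow,
      DihedralGroup.r_mul_sr, DihedralGroup.sr_mul_r] at h2
    have h3 : (Int.cast (-k) : ZMod 0) = Int.cast k := by
      rw [Int.cast_neg]
      simpa using h2
    rw [ZMod.intCast_eq_intCast_iff] at h3
    have h4 : -k = k := by simpa [Int.ModEq] using h3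
    omega
  have ht : t ≠ 1 := by
    rintro rfl
    simp at hc
  have htt : t * t = 1 := by
    rw [← hft, ← map_mul, ← map_mul, ← ofAdd_add,
      show (1 : ZMod 2) + 1 = 0 from rfl, ofAdd_zero, map_one, map_one]
  set u : Γ := s ^ (-k) * t * s ^ k with hu
  have hu1 : u ≠ 1 := by
    intro h
    apply ht
    have : t = s ^ k * u * s ^ (-k) := by rw [hu]; group
    rw [this, h]; group
  have hut : u ≠ t := by
    intro h
    apply hc
    rw [← h, hu] 
    nth_rewrite 2 [← hu]
    rw [h]; group
  have htinv : t⁻¹ = t := inv_eq_of_mul_eq_one_left htt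
  have e2 : u * t ≠ 1 := fun h => hut (by rw [eq_inv_of_mul_eq_one_left h, htinv])
  have e3 : t * u ≠ 1 := fun h => hut (by rw [eq_inv_of_mul_eq_one_right h, htinv])
  have e4 : t * u * t ≠ 1 := fun h => hu1 (by
    have : u = t * (t * u * t) * t := by
      calc u = (t * t) * u * (t * t) := by rw [htt]; simp
        _ = _ := by group
    rw [this, h, mul_one, htt])
  have key : (1 + MonoidAlgebra.of ℂ Γ t) * MonoidAlgebra.of ℂ Γ (s ^ (-k)) *
          (1 - MonoidAlgebra.of ℂ Γ t) * MonoidAlgebra.of ℂ Γ (s ^ k) *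
          (1 + MonoidAlgebra.of ℂ Γ t) =
      MonoidAlgebra.of ℂ Γ 1 + MonoidAlgebra.of ℂ Γ 1 + MonoidAlgebra.of ℂ Γ t
        + MonoidAlgebra.of ℂ Γ t
        - MonoidAlgebra.of ℂ Γ u - MonoidAlgebra.of ℂ Γ (u * t)
        - MonoidAlgebra.of ℂ Γ (t * u) - MonoidAlgebra.of ℂ Γ (t * u * t) := by
    have a1 : MonoidAlgebra.of ℂ Γ (s ^ (-k)) * MonoidAlgebra.of ℂ Γ (s ^ k) = 1 := by
      rw [← map_mul, ← zpow_add, neg_add_cancel, zpow_zero, map_one]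
    have a2 : MonoidAlgebra.of ℂ Γ t * MonoidAlgebra.of ℂ Γ t = 1 := by
      rw [← map_mul, htt, map_one]
    simp only [hu, map_mul, map_one]
    generalize MonoidAlgebra.of ℂ Γ (s ^ (-k)) = A at *
    generalize MonoidAlgebra.of ℂ Γ (s ^ k) = B at *
    generalize MonoidAlgebra.of ℂ Γ t = T at *
    calc (1 + T) * A * (1 - T) * B * (1 + T)
        = (1 + T) * (A * B) * (1 + T) - (1 + T) * (A * T * B) * (1 + T) := by noncomm_ring
      _ = 1 + T + T + T * T - (1 + T) * (A * T * B) * (1 + T) := by rw [a1]; noncomm_ring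
      _ = _ := by rw [a2]; noncomm_ring
  rw [key] at h0
  have h1 := congrArg (fun x : MonoidAlgebra ℂ Γ => x.coeff 1) h0
  simp [MonoidAlgebra.of_apply, Finsupp.single_apply, ht, hu1, e2, e3, e4] at h1
end

section
/- Let g₀ be the element of SL(3,ℤ) whose underlying matrix is !![0,0,1; 1,0,1; 0,1,0], and let σ : SL(3,ℤ) → SL(3,ℤ) denote the inverse-transpose automorphism σ(A) = (Aᵀ)⁻¹. Then for every s ∈ SL(3,ℤ), one has σ(s⁻¹ * g₀ * s) ≠ s⁻¹ * g₀ * s. In particular, g₀ is not conjugate in SL(3,ℤ) to (g₀ᵀ)⁻¹. -/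
/-- The matrix `!![0,0,1; 1,0,1; 0,1,0]` as an element of `SL(3,ℤ)`. -/
def gZero : Matrix.SpecialLinearGroup (Fin 3) ℤ :=
  ⟨!![0, 0, 1; 1, 0, 1; 0, 1, 0], by decide⟩

/-- The inverse-transpose automorphism `A ↦ (Aᵀ)⁻¹` of `SL(3,ℤ)` (as a function). -/
def invTranspose (A : Matrix.SpecialLinearGroup (Fin 3) ℤ) :
    Matrix.SpecialLinearGroup (Fin 3) ℤ :=
  (Matrix.SpecialLinearGroup.transpose A)⁻¹

theorem trace_conj_aux (s g : Matrix.SpecialLinearGroup (Fin 3) ℤ) :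
    Matrix.trace (s⁻¹ * g * s).1 = Matrix.trace g.1 := by
  have h : (s⁻¹ * g * s).1 = (s⁻¹).1 * (g.1 * s.1) := by
    rw [mul_assoc]; rfl
  rw [h, Matrix.trace_mul_comm, Matrix.mul_assoc]
  have h2 : s.1 * (s⁻¹).1 = 1 := congrArg Subtype.val (mul_inv_cancel s)
  rw [h2, Matrix.mul_one]

theorem trace_invTranspose_aux (g : Matrix.SpecialLinearGroup (Fin 3) ℤ) :
    Matrix.trace (invTranspose g).1 = Matrix.trace (g⁻¹).1 := by
  unfold invTranspose
  simp only [Matrix.SpecialLinearGroup.coe_inv, Matrix.SpecialLinearGroup.coe_transpose,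
    Matrix.adjugate_transpose, ← Matrix.adjugate_transpose, Matrix.trace_transpose]

theorem trace_gZero_aux : Matrix.trace gZero.1 = 0 := by decide

theorem trace_gZero_inv_aux : Matrix.trace (gZero⁻¹).1 = -1 := by
  rw [Matrix.SpecialLinearGroup.coe_inv]
  simp [gZero, Matrix.adjugate_fin_three_of, Matrix.trace_fin_three]

theorem stmt_13 :
    (∀ s : Matrix.SpecialLinearGroup (Fin 3) ℤ,
      invTranspose (s⁻¹ * gZero * s) ≠ s⁻¹ * gZero * s) ∧
    ¬ IsConj gZero (invTranspose gZero) := by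
  constructor
  · intro s h
    have h1 := congrArg (fun x => Matrix.trace x.1) h
    have e : (s⁻¹ * gZero * s)⁻¹ = s⁻¹ * gZero⁻¹ * s := by group
    simp only [trace_invTranspose_aux] at h1
    rw [e, trace_conj_aux, trace_conj_aux, trace_gZero_aux, trace_gZero_inv_aux] at h1
    omega
  · intro h
    obtain ⟨c, hc⟩ := isConj_iff.1 h
    have h1 := congrArg (fun x => Matrix.trace x.1) hc
    have h2 := trace_conj_aux c⁻¹ gZero
    rw [inv_inv] at h2
    simp only [trace_invTranspose_aux] at h1
    rw [h2, trace_gZero_aux, trace_gZero_inv_aux] at h1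
    omega
end

section
/- Let F₂ = FreeGroup (Fin 2) with generators a = FreeGroup.of 0 and b = FreeGroup.of 1, and let |·| = FreeGroup.norm denote reduced word length. Then for every x ∈ F₂ and every n ∈ ℕ with n > |x|, one has |b⁻ⁿ * a⁻ⁿ * x * bⁿ * aⁿ| ≥ 4n − |x|. -/
theorem aux_decomp {α : Type*} (s t : α) : ∀ (m : ℕ) (L : List α), L.length = m →
    ∃ (p : ℕ) (w : List α) (q : ℕ), L = List.replicate p s ++ (w ++ List.replicate q t) ∧
      (∀ y ∈ w.head?, y ≠ s) ∧ (∀ y ∈ w.getLast?, y ≠ t) := by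
  intro m
  induction m with
  | zero =>
    intro L hL
    exact ⟨0, [], 0, by simpa using hL, by simp, by simp⟩
  | succ m ih =>
    intro L hL
    by_cases h1 : ∃ L', L = s :: L'
    · obtain ⟨L', rfl⟩ := h1
      obtain ⟨p, w, q, h, hs, ht⟩ := ih L' (by simpa using hL)
      exact ⟨p + 1, w, q, by rw [h]; simp [List.replicate_succ], hs, ht⟩
    by_cases h2 : ∃ L', L = L' ++ [t]
    · obtain ⟨L', rfl⟩ := h2
      obtain ⟨p, w, q, h, hs, ht⟩ := ih L' (by simpa using hL)
      exact ⟨p, w, q + 1, by rw [h]; simp [List.replicate_succ'], hs, ht⟩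
    refine ⟨0, L, 0, by simp, ?_, ?_⟩
    · rintro y hy rfl
      exact h1 ((List.head?_eq_some_iff).1 hy)
    · rintro y hy rfl
      exact h2 ((List.getLast?_eq_some_iff).1 hy)

theorem aux_pow {α : Type*} [DecidableEq α] (a : α) (n : ℕ) :
    FreeGroup.of a ^ n = FreeGroup.mk (List.replicate n (a, true)) := by
  rw [← FreeGroup.toWord_of_pow, FreeGroup.mk_toWord]

theorem aux_pow_inv {α : Type*} [DecidableEq α] (a : α) (n : ℕ) :
    (FreeGroup.of a ^ n)⁻¹ = FreeGroup.mk (List.replicate n (a, false)) := by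
  rw [aux_pow, FreeGroup.inv_mk]
  simp [FreeGroup.invRev]

theorem aux_red_replicate {α : Type*} (s : α × Bool) (n : ℕ) :
    FreeGroup.IsReduced (List.replicate n s) := by
  unfold FreeGroup.IsReduced
  exact List.isChain_replicate_of_rel _ (fun _ => rfl)

theorem aux_reduced (w : List (Fin 2 × Bool)) (n j k : ℕ) (hj : j ≠ 0) (hk : k ≠ 0)
    (hw : FreeGroup.IsReduced w) (hs : ∀ y ∈ w.head?, y ≠ (0, true))
    (ht : ∀ y ∈ w.getLast?, y ≠ (1, false)) :
    FreeGroup.IsReduced (List.replicate n ((1 : Fin 2), false) ++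
      (List.replicate j ((0 : Fin 2), false) ++ (w ++ (List.replicate k ((1 : Fin 2), true) ++
        List.replicate n ((0 : Fin 2), true))))) := by
  have r := aux_red_replicate (α := Fin 2)
  unfold FreeGroup.IsReduced at *
  refine (r _ _).append ((r _ _).append (hw.append ((r _ _).append (r _ _) ?_) ?_) ?_) ?_
  · simp +contextual [List.getLast?_replicate, List.head?_replicate, hk]
  · rintro ⟨x, b⟩ hx y hy
    have := ht _ hx
    simp [List.head?_append, List.head?_replicate, hk] at hy
    subst hy
    rintro rfl
    cases b <;> simp_all
  · intro x hx y hy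
    simp [List.getLast?_replicate, hj] at hx
    subst hx
    obtain ⟨y, b⟩ := y
    cases w with
    | nil =>
      simp [List.head?_append, List.head?_replicate, hk] at hy
      simp [← hy.1]
    | cons z w =>
      have := hs (y, b) (by simpa using hy)
      rintro rfl
      cases b <;> simp_all
  · intro x hx y hy
    simp [List.getLast?_replicate] at hx
    simp [List.head?_append, List.head?_replicate, hj] at hy
    simp [← hy, ← hx.2]

theorem stmt_14 (x : FreeGroup (Fin 2)) (n : ℕ) (hn : FreeGroup.norm x < n) :
    4 * n - FreeGroup.norm x ≤
      FreeGroup.norm (((FreeGroup.of (1 : Fin 2)) ^ n)⁻¹ *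
        ((FreeGroup.of (0 : Fin 2)) ^ n)⁻¹ * x *
        (FreeGroup.of (1 : Fin 2)) ^ n * (FreeGroup.of (0 : Fin 2)) ^ n) := by
  obtain ⟨p, w, q, h, hs, ht⟩ := aux_decomp ((0 : Fin 2), true) ((1 : Fin 2), false) _ x.toWord rfl
  have hr : FreeGroup.IsReduced x.toWord := FreeGroup.isReduced_toWord
  have hw : FreeGroup.IsReduced w := by
    rw [h] at hr
    unfold FreeGroup.IsReduced at *
    exact hr.right_of_append.left_of_append
  have hlen : FreeGroup.norm x = p + (w.length + q) := by
    simp [FreeGroup.norm, h]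
  have hx : x = FreeGroup.of 0 ^ p * FreeGroup.mk w * (FreeGroup.of 1 ^ q)⁻¹ := by
    rw [aux_pow, aux_pow_inv, FreeGroup.mul_mk, FreeGroup.mul_mk, List.append_assoc, ← h,
      FreeGroup.mk_toWord]
  obtain ⟨j, rfl⟩ : ∃ j, n = p + j := ⟨n - p, by omega⟩
  obtain ⟨k, hk⟩ : ∃ k, p + j = q + k := ⟨p + j - q, by omega⟩
  have key : ((FreeGroup.of (1 : Fin 2)) ^ (p + j))⁻¹ *
        ((FreeGroup.of (0 : Fin 2)) ^ (p + j))⁻¹ * x *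
        (FreeGroup.of (1 : Fin 2)) ^ (p + j) * (FreeGroup.of (0 : Fin 2)) ^ (p + j) =
      FreeGroup.mk (List.replicate (p + j) ((1 : Fin 2), false) ++
      (List.replicate j ((0 : Fin 2), false) ++ (w ++ (List.replicate k ((1 : Fin 2), true) ++
        List.replicate (p + j) ((0 : Fin 2), true))))) := by
    simp only [← FreeGroup.mul_mk, ← aux_pow, ← aux_pow_inv]
    have e1 : (FreeGroup.of (1 : Fin 2)) ^ (p + j) = FreeGroup.of 1 ^ q * FreeGroup.of 1 ^ k := by
      rw [hk, pow_add]
    have e0 := pow_add (FreeGroup.of (0 : Fin 2)) p j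
    rw [e1, e0, hx]
    group
  have hred := aux_reduced w (p + j) j k (by omega) (by omega) hw hs ht
  rw [key, hlen, FreeGroup.norm, FreeGroup.toWord_mk, hred.reduce_eq]
  simp only [List.length_append, List.length_replicate]
  omega
end

section
/- Let F₂ = FreeGroup (Fin 2) with generators a = FreeGroup.of 0 and b = FreeGroup.of 1, and let |·| = FreeGroup.norm denote reduced word length. Then for every x ∈ F₂ with x ≠ 1, the word lengths |b⁻ⁿ * a⁻ⁿ * x * aⁿ * bⁿ| tend to infinity as n → ∞. -/
open FreeGroup in
/-- If a word is reduced and begins and ends with letters over `0`, conjugating by `b ^ n`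
does not cancel. -/
theorem conj_norm_ge (L : List (Fin 2 × Bool)) (hL : IsReduced L)
    (hne : L ≠ []) (hh : ∀ c ∈ L.head?, c.1 = 0) (hl : ∀ c ∈ L.getLast?, c.1 = 0) (n : ℕ) :
    n ≤ norm (((of (1 : Fin 2)) ^ n)⁻¹ * mk L * (of (1 : Fin 2)) ^ n) := by
  have e1 : ((of (1 : Fin 2)) ^ n) = mk (List.replicate n (1, true)) := by
    rw [← toWord_of_pow, mk_toWord]
  have e2 : ((of (1 : Fin 2)) ^ n)⁻¹ = mk (List.replicate n (1, false)) := by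
    rw [e1, inv_mk]; simp [invRev]
  have hred : IsReduced (List.replicate n ((1 : Fin 2), false) ++ L ++
      List.replicate n ((1 : Fin 2), true)) := by
    unfold FreeGroup.IsReduced at *
    rw [List.isChain_append, List.isChain_append]
    refine ⟨⟨List.isChain_replicate_of_rel _ (by simp), hL, ?_⟩,
      List.isChain_replicate_of_rel _ (by simp), ?_⟩
    · intro c hc d hd h
      have h1 := List.eq_of_mem_replicate (List.mem_of_getLast? hc)
      have h2 := hh d hd
      simp [h1, h2] at h
    · intro c hc d hd h
      have h1 := List.eq_of_mem_replicate (List.mem_of_head? hd)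
      rw [List.getLast?_append_of_ne_nil _ hne] at hc
      have h2 := hl c hc
      simp [h1, h2] at h
  rw [e2, e1, mul_mk, mul_mk, FreeGroup.norm, toWord_mk, hred.reduce_eq]
  simp

open FreeGroup in
/-- Words over the letter `0` represent powers of `a`. -/
theorem mk_eq_zpow (L : List (Fin 2 × Bool)) (h : ∀ c ∈ L, c.1 = 0) :
    ∃ k : ℤ, mk L = (of (0 : Fin 2)) ^ k := by
  induction L with
  | nil => exact ⟨0, by simp [one_eq_mk]⟩
  | cons c L ih =>
    obtain ⟨k, hk⟩ := ih (fun d hd => h d (List.mem_cons_of_mem _ hd))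
    have h0 : c.1 = 0 := h c (by simp)
    obtain ⟨c1, c2⟩ := c
    simp only at h0
    subst h0
    have e : mk (((0 : Fin 2), c2) :: L) = mk [((0 : Fin 2), c2)] * mk L := by
      rw [mul_mk]; rfl
    rw [e, hk]
    cases c2 with
    | true => exact ⟨1 + k, by rw [zpow_add, zpow_one]; rfl⟩
    | false =>
      refine ⟨-1 + k, ?_⟩
      rw [zpow_add, zpow_neg_one]; rfl

open FreeGroup in
theorem of_pow_eq (n : ℕ) : (of (0 : Fin 2)) ^ n = mk (List.replicate n (0, true)) := by
  rw [← toWord_of_pow, mk_toWord]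

open FreeGroup in
theorem of_pow_inv_eq (n : ℕ) :
    ((of (0 : Fin 2)) ^ n)⁻¹ = mk (List.replicate n (0, false)) := by
  rw [of_pow_eq, inv_mk]; simp [invRev]

open FreeGroup in
/-- Every element is a power of `a`, or is `a ^ i * w * a ^ j` with `w` a reduced
word beginning and ending with letters over `1`. -/
theorem decomp_s15 (x : FreeGroup (Fin 2)) :
    (∃ k : ℤ, x = (of (0 : Fin 2)) ^ k) ∨
    ∃ (i j : ℤ) (w : List (Fin 2 × Bool)), IsReduced w ∧ w ≠ [] ∧
      (∀ c ∈ w.head?, c.1 ≠ 0) ∧ (∀ c ∈ w.getLast?, c.1 ≠ 0) ∧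
      x = (of (0 : Fin 2)) ^ i * mk w * (of (0 : Fin 2)) ^ j := by
  let P : Fin 2 × Bool → Bool := fun c => decide (c.1 = 0)
  set L := x.toWord with hL
  have hx : mk L = x := mk_toWord
  have hLr : IsReduced L := isReduced_toWord
  have s1 : L.takeWhile P ++ L.dropWhile P = L := List.takeWhile_append_dropWhile
  set r := L.dropWhile P with hr
  obtain ⟨i, hi⟩ := mk_eq_zpow (L.takeWhile P) (fun c hc => by
    simpa [P] using List.mem_takeWhile_imp hc)
  have s2 : r.rdropWhile P ++ r.rtakeWhile P = r := by
    simp [List.rdropWhile, List.rtakeWhile, ← List.reverse_append]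
  obtain ⟨j, hj⟩ := mk_eq_zpow (r.rtakeWhile P) (fun c hc => by
    simpa [P] using List.mem_rtakeWhile_imp hc)
  have hxe : x = (of (0 : Fin 2)) ^ i * mk (r.rdropWhile P) * (of (0 : Fin 2)) ^ j := by
    rw [← hi, ← hj, mul_assoc, mul_mk, mul_mk, s2, s1, hx]
  by_cases hw : r.rdropWhile P = []
  · left
    refine ⟨i + j, ?_⟩
    rw [hxe, hw, zpow_add, ← one_eq_mk, mul_one]
  · right
    refine ⟨i, j, _, ?_, hw, ?_, ?_, hxe⟩
    · unfold FreeGroup.IsReduced at *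
      rw [← s1, ← s2] at hLr
      exact ((List.isChain_append.1 (List.isChain_append.1 hLr).2.1)).1
    · intro c hc
      have : c ∈ r.head? := by
        rw [← s2, List.head?_append_of_ne_nil _ hw]; exact hc
      have h := List.head?_dropWhile_not P L
      rw [← hr, Option.mem_def.1 this] at h
      simpa [P] using h
    · intro c hc
      have h := List.rdropWhile_last_not P r hw
      rw [List.getLast?_eq_some_getLast hw] at hc
      simp only [Option.mem_def, Option.some.injEq] at hc
      rw [hc] at h
      simpa [P] using h

theorem stmt_15 (x : FreeGroup (Fin 2)) (hx : x ≠ 1) :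
    Filter.Tendsto
      (fun n : ℕ => FreeGroup.norm (((FreeGroup.of (1 : Fin 2)) ^ n)⁻¹ *
        ((FreeGroup.of (0 : Fin 2)) ^ n)⁻¹ * x *
        (FreeGroup.of (0 : Fin 2)) ^ n * (FreeGroup.of (1 : Fin 2)) ^ n))
      Filter.atTop Filter.atTop := by
  suffices H : ∃ N : ℕ, ∀ n ≥ N, ∃ L : List (Fin 2 × Bool), FreeGroup.IsReduced L ∧ L ≠ [] ∧
      (∀ c ∈ L.head?, c.1 = 0) ∧ (∀ c ∈ L.getLast?, c.1 = 0) ∧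
      ((FreeGroup.of (0 : Fin 2)) ^ n)⁻¹ * x * (FreeGroup.of (0 : Fin 2)) ^ n
        = FreeGroup.mk L by
    obtain ⟨N, hN⟩ := H
    refine Filter.tendsto_atTop_mono' _ ?_ Filter.tendsto_id
    filter_upwards [Filter.eventually_ge_atTop N] with n hn
    obtain ⟨L, h1, h2, h3, h4, h5⟩ := hN n hn
    have := conj_norm_ge L h1 h2 h3 h4 n
    rw [← h5] at this
    simpa only [mul_assoc, id] using this
  have hrep : ∀ (m : ℕ) (s : Bool),
      FreeGroup.IsReduced (List.replicate m ((0 : Fin 2), s)) := fun m s =>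
    List.isChain_replicate_of_rel _ (by simp)
  rcases decomp_s15 x with ⟨k, rfl⟩ | ⟨i, j, w, hw, hwne, hwh, hwl, rfl⟩
  · refine ⟨0, fun n _ => ?_⟩
    have e : ((FreeGroup.of (0 : Fin 2)) ^ n)⁻¹ * (FreeGroup.of (0 : Fin 2)) ^ k *
        (FreeGroup.of (0 : Fin 2)) ^ n = (FreeGroup.of (0 : Fin 2)) ^ k := by
      group
    rw [e]
    have key : ∀ (m : ℕ) (s : Bool), m ≠ 0 → FreeGroup.IsReduced (List.replicate m ((0 : Fin 2), s)) ∧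
        List.replicate m ((0 : Fin 2), s) ≠ [] ∧
        (∀ c ∈ (List.replicate m ((0 : Fin 2), s)).head?, c.1 = 0) ∧
        (∀ c ∈ (List.replicate m ((0 : Fin 2), s)).getLast?, c.1 = 0) := by
      intro m s hm
      refine ⟨hrep m s, by simpa using hm, fun c hc => ?_, fun c hc => ?_⟩
      · rw [List.eq_of_mem_replicate (List.mem_of_head? hc)]
      · rw [List.eq_of_mem_replicate (List.mem_of_getLast? hc)]
    obtain ⟨m, rfl | rfl⟩ := k.eq_nat_or_neg
    · have hm : m ≠ 0 := by rintro rfl; simp at hx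
      obtain ⟨h1, h2, h3, h4⟩ := key m true hm
      exact ⟨_, h1, h2, h3, h4, by rw [zpow_natCast, of_pow_eq]⟩
    · have hm : m ≠ 0 := by rintro rfl; simp at hx
      obtain ⟨h1, h2, h3, h4⟩ := key m false hm
      exact ⟨_, h1, h2, h3, h4, by rw [zpow_neg, zpow_natCast, of_pow_inv_eq]⟩
  · refine ⟨i.natAbs + j.natAbs + 1, fun n hn => ?_⟩
    obtain ⟨p, hp⟩ : ∃ p : ℕ, (n : ℤ) - i = (p + 1 : ℕ) := ⟨(n - i - 1).toNat, by omega⟩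
    obtain ⟨q, hq⟩ : ∃ q : ℕ, j + (n : ℤ) = (q + 1 : ℕ) := ⟨(j + n - 1).toNat, by omega⟩
    refine ⟨List.replicate (p + 1) (0, false) ++ w ++ List.replicate (q + 1) (0, true),
      ?_, by simp, ?_, ?_, ?_⟩
    · unfold FreeGroup.IsReduced at *
      rw [List.isChain_append, List.isChain_append]
      refine ⟨⟨hrep _ _, hw, ?_⟩, hrep _ _, ?_⟩
      · intro c hc d hd h
        have h1 := List.eq_of_mem_replicate (List.mem_of_getLast? hc)
        exact absurd (by rw [← h, h1]) (hwh d hd)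
      · intro c hc d hd h
        have h1 := List.eq_of_mem_replicate (List.mem_of_head? hd)
        rw [List.getLast?_append_of_ne_nil _ hwne] at hc
        exact absurd (by rw [h, h1]) (hwl c hc)
    · intro c hc
      simp [List.replicate_succ] at hc
      simp [← hc]
    · intro c hc
      rw [List.getLast?_append_of_ne_nil _ (by simp)] at hc
      rw [List.eq_of_mem_replicate (List.mem_of_getLast? hc)]
    · rw [← FreeGroup.mul_mk, ← FreeGroup.mul_mk, ← of_pow_eq, ← of_pow_inv_eq,
        ← zpow_natCast _ (p + 1), ← zpow_natCast _ (q + 1), ← hp, ← hq]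
      group
end

section
/- Let α be a type, i ∈ α, and set a = FreeGroup.of i in the free group FreeGroup α. Let g ∈ FreeGroup α be an element that is not an integer power of a (i.e., g does not lie in the cyclic subgroup Subgroup.zpowers a). Then the reduced word lengths FreeGroup.norm (a⁻ᵏ * g * aᵏ) tend to infinity as k → ∞. -/
theorem aux_decomp_s16 {α : Type*} [DecidableEq α] (i : α) : ∀ (n : ℕ) (L : List (α × Bool)),
    L.length = n → FreeGroup.IsReduced L →
    FreeGroup.mk L ∉ Subgroup.zpowers (FreeGroup.of i) →
    ∃ (p q : ℤ) (h : List (α × Bool)), FreeGroup.IsReduced h ∧ h ≠ [] ∧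
      (∀ x ∈ h.head?, x.1 ≠ i) ∧ (∀ x ∈ h.getLast?, x.1 ≠ i) ∧
      FreeGroup.mk L = FreeGroup.of i ^ p * FreeGroup.mk h * FreeGroup.of i ^ q := by
  intro n
  have single : ∀ b : Bool, ∃ e : ℤ, FreeGroup.mk [(i, b)] = FreeGroup.of i ^ e := by
    intro b
    cases b
    · exact ⟨-1, by rw [zpow_neg_one]; rfl⟩
    · exact ⟨1, by rw [zpow_one]; rfl⟩
  induction n with
  | zero =>
    intro L hL _ hm
    rw [List.length_eq_zero_iff] at hL
    subst hL
    exact absurd (Subgroup.one_mem _) hm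
  | succ n ih =>
    intro L hL hr hm
    by_cases h1 : ∀ x ∈ L.head?, x.1 ≠ i
    · by_cases h2 : ∀ x ∈ L.getLast?, x.1 ≠ i
      · refine ⟨0, 0, L, hr, ?_, h1, h2, by simp⟩
        rintro rfl
        simp at hL
      · push Not at h2
        obtain ⟨⟨y, b⟩, hx, rfl⟩ := h2
        obtain ⟨T, rfl⟩ : ∃ T, L = T ++ [(y, b)] := by
          obtain ⟨T, hT⟩ := List.getLast?_eq_some_iff.1 hx
          exact ⟨T, hT⟩
        obtain ⟨e, he⟩ := single b
        have hmk : FreeGroup.mk (T ++ [(y, b)]) = FreeGroup.mk T * FreeGroup.of y ^ e := by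
          rw [← he, FreeGroup.mul_mk]
        obtain ⟨p, q, h, a1, a2, a3, a4, a5⟩ := ih T (by simpa using hL)
          (List.IsChain.left_of_append hr) (by
            intro hc
            apply hm
            rw [hmk]
            exact Subgroup.mul_mem _ hc (Subgroup.zpow_mem _ (Subgroup.mem_zpowers _) _))
        exact ⟨p, q + e, h, a1, a2, a3, a4, by rw [hmk, a5, zpow_add]; simp only [mul_assoc]⟩
    · push Not at h1
      obtain ⟨⟨y, b⟩, hx, rfl⟩ := h1
      obtain ⟨T, rfl⟩ : ∃ T, L = [(y, b)] ++ T := by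
        obtain ⟨T, hT⟩ := List.head?_eq_some_iff.1 hx
        exact ⟨T, hT⟩
      obtain ⟨e, he⟩ := single b
      have hmk : FreeGroup.mk ([(y, b)] ++ T) = FreeGroup.of y ^ e * FreeGroup.mk T := by
        rw [← he, FreeGroup.mul_mk]
      obtain ⟨p, q, h, a1, a2, a3, a4, a5⟩ := ih T (by simpa using hL)
        (List.IsChain.right_of_append hr) (by
          intro hc
          apply hm
          rw [hmk]
          exact Subgroup.mul_mem _ (Subgroup.zpow_mem _ (Subgroup.mem_zpowers _) _) hc)
      exact ⟨e + p, q, h, a1, a2, a3, a4, by rw [hmk, a5, zpow_add]; simp only [mul_assoc]⟩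

theorem aux_norm {α : Type*} [DecidableEq α] (i : α) (h : List (α × Bool)) (K N : ℕ)
    (hr : FreeGroup.IsReduced h) (h0 : h ≠ [])
    (h1 : ∀ x ∈ h.head?, x.1 ≠ i) (h2 : ∀ x ∈ h.getLast?, x.1 ≠ i) :
    N ≤ FreeGroup.norm ((FreeGroup.of i ^ K)⁻¹ * FreeGroup.mk h * FreeGroup.of i ^ N) := by
  have e : (FreeGroup.of i ^ K)⁻¹ * FreeGroup.mk h * FreeGroup.of i ^ N =
      FreeGroup.mk (List.replicate K (i, false) ++ (h ++ List.replicate N (i, true))) := by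
    rw [← FreeGroup.mk_toWord (x := FreeGroup.of i ^ K),
      ← FreeGroup.mk_toWord (x := FreeGroup.of i ^ N), FreeGroup.toWord_of_pow,
      FreeGroup.toWord_of_pow, FreeGroup.inv_mk, FreeGroup.mul_mk, FreeGroup.mul_mk]
    simp [FreeGroup.invRev]
  have hred : FreeGroup.IsReduced
      (List.replicate K (i, false) ++ (h ++ List.replicate N (i, true))) := by
    unfold FreeGroup.IsReduced at *
    rw [List.isChain_append, List.isChain_append]
    refine ⟨List.isChain_replicate_of_rel _ (fun _ => rfl),
      ⟨hr, List.isChain_replicate_of_rel _ (fun _ => rfl), ?_⟩, ?_⟩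
    · intro x hx y hy hxy
      have := List.eq_of_mem_replicate (List.mem_of_mem_head? hy)
      subst this
      exact absurd hxy (h2 x hx)
    · intro x hx y hy hxy
      have := List.eq_of_mem_replicate (List.mem_of_mem_getLast? hx)
      subst this
      rw [List.head?_append_of_ne_nil _ h0] at hy
      exact absurd hxy.symm (h1 y hy)
  rw [e, FreeGroup.norm, FreeGroup.toWord_mk, hred.reduce_eq]
  simp only [List.length_append, List.length_replicate]
  omega

theorem stmt_16 {α : Type*} [DecidableEq α] (i : α) (g : FreeGroup α)
    (hg : g ∉ Subgroup.zpowers (FreeGroup.of i)) :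
    Filter.Tendsto
      (fun k : ℕ => FreeGroup.norm (((FreeGroup.of i) ^ k)⁻¹ * g * (FreeGroup.of i) ^ k))
      Filter.atTop Filter.atTop := by
  obtain ⟨p, q, h, a1, a2, a3, a4, a5⟩ := aux_decomp_s16 i _ g.toWord rfl
    FreeGroup.isReduced_toWord (by rwa [FreeGroup.mk_toWord])
  rw [FreeGroup.mk_toWord] at a5
  rw [Filter.tendsto_atTop_atTop]
  intro b
  refine ⟨p.natAbs + q.natAbs + b, fun k hk => ?_⟩
  obtain ⟨K, hK⟩ := Int.eq_ofNat_of_zero_le (show 0 ≤ (k : ℤ) - p by omega)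
  obtain ⟨N, hN⟩ := Int.eq_ofNat_of_zero_le (show 0 ≤ q + (k : ℤ) by omega)
  have e : ((FreeGroup.of i) ^ k)⁻¹ * g * (FreeGroup.of i) ^ k =
      (FreeGroup.of i ^ K)⁻¹ * FreeGroup.mk h * FreeGroup.of i ^ N := by
    rw [a5, ← zpow_natCast _ K, ← zpow_natCast _ N, ← zpow_natCast _ k, ← hK, ← hN]
    group
  show b ≤ FreeGroup.norm _
  rw [e]
  have := aux_norm i h K N a1 a2 a3 a4
  omega
end
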